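/- arXiv:0906.2388 — 2 statements merged into one kernel-verified Lean document; each statement's English description precedes it below -/
import Mathlib

section
/- Let P be a generic convex polygon with n ≥ 5 vertices and let V_i be a globally maximal-extremal vertex of P. Let P′ be the polygon obtained from P by removing the vertex V_i and joining V_{i-1} and V_{i+1} by an edge. Then either s_-(P) = s_-(P′) or s_-(P) = s_-(P′) + 1. -/
open EuclideanGeometry
open scoped Classical

noncomputable section

/-- The Euclidean plane. -/
abbrev Pt := EuclideanSpace ℝ (Fin 2)

/-- Signed area determinant of the triangle `a b c` (positive iff `a b c` is
counterclockwise, i.e. `c` lies strictly to the left of the directed line `a → b`). -/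
def det2 (a b c : Pt) : ℝ :=
  (b 0 - a 0) * (c 1 - a 1) - (b 1 - a 1) * (c 0 - a 0)

/-- The vertices `V 0, V 1, …, V (n-1)` (indices mod `n`) are distinct and in convex
position, listed counterclockwise: every other vertex lies strictly to the left of
each directed edge. -/
def ConvexCCW {n : ℕ} (V : ZMod n → Pt) : Prop :=
  Function.Injective V ∧
    ∀ i j : ZMod n, j ≠ i → j ≠ i + 1 → 0 < det2 (V i) (V (i + 1)) (V j)

/-- The polygon is generic: no three vertices are collinear and no four vertices lie
on a common circle. -/
def GenericPoly {n : ℕ} (V : ZMod n → Pt) : Prop :=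
  (∀ i j k : ZMod n, i ≠ j → j ≠ k → i ≠ k →
      ¬ Collinear ℝ ({V i, V j, V k} : Set Pt)) ∧
  (∀ i j k l : ZMod n, i ≠ j → i ≠ k → i ≠ l → j ≠ k → j ≠ l → k ≠ l →
      ¬ ∃ (O : Pt) (R : ℝ),
        dist (V i) O = R ∧ dist (V j) O = R ∧ dist (V k) O = R ∧ dist (V l) O = R)

/-- `O i` is the center and `R i` the radius of the circle `C i` through
`V (i-1)`, `V i`, `V (i+1)`. -/
def IsCircumData {n : ℕ} (V O : ZMod n → Pt) (R : ZMod n → ℝ) : Prop :=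
  ∀ i : ZMod n,
    dist (V (i - 1)) (O i) = R i ∧ dist (V i) (O i) = R i ∧
      dist (V (i + 1)) (O i) = R i

/-- The polygon is coherent: each circumcenter `O i` lies in the closed infinite cone
with apex `V i` spanned by the rays from `V i` through `V (i-1)` and `V (i+1)`. -/
def Coherent {n : ℕ} (V O : ZMod n → Pt) : Prop :=
  ∀ i : ZMod n, ∃ s t : ℝ, 0 ≤ s ∧ 0 ≤ t ∧
    O i - V i = s • (V (i - 1) - V i) + t • (V (i + 1) - V i)

/-- `V i` is locally maximal-extremal: `V (i-2)` and `V (i+2)` lie strictly outside `C i`. -/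
def LocMax {n : ℕ} (V O : ZMod n → Pt) (R : ZMod n → ℝ) (i : ZMod n) : Prop :=
  R i < dist (V (i - 2)) (O i) ∧ R i < dist (V (i + 2)) (O i)

/-- `V i` is locally minimal-extremal: `V (i-2)` and `V (i+2)` lie strictly inside `C i`. -/
def LocMin {n : ℕ} (V O : ZMod n → Pt) (R : ZMod n → ℝ) (i : ZMod n) : Prop :=
  dist (V (i - 2)) (O i) < R i ∧ dist (V (i + 2)) (O i) < R i

/-- `V i` is globally maximal-extremal: the open disk bounded by `C i` contains no vertex. -/
def GlobMax {n : ℕ} (V O : ZMod n → Pt) (R : ZMod n → ℝ) (i : ZMod n) : Prop :=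
  ∀ j : ZMod n, R i ≤ dist (V j) (O i)

/-- `V i` is globally minimal-extremal: the open disk bounded by `C i` contains every
vertex other than `V (i-1)`, `V i`, `V (i+1)`. -/
def GlobMin {n : ℕ} (V O : ZMod n → Pt) (R : ZMod n → ℝ) (i : ZMod n) : Prop :=
  ∀ j : ZMod n, j ≠ i - 1 → j ≠ i → j ≠ i + 1 → dist (V j) (O i) < R i

/-- `V i` is radially maximal-extremal: `R (i-1) < R i > R (i+1)`. -/
def RadMax {n : ℕ} (R : ZMod n → ℝ) (i : ZMod n) : Prop :=
  R (i - 1) < R i ∧ R (i + 1) < R i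

/-- `V i` is radially minimal-extremal: `R (i-1) > R i < R (i+1)`. -/
def RadMin {n : ℕ} (R : ZMod n → ℝ) (i : ZMod n) : Prop :=
  R i < R (i - 1) ∧ R i < R (i + 1)

end

noncomputable section

/-- The polygon obtained from `V` by deleting the vertex `V i` and joining `V (i-1)`
to `V (i+1)`; its vertices, listed in order, are `V (i+1), V (i+2), …, V (i+n-1)`. -/
def removeVertex {n : ℕ} [NeZero n] (V : ZMod n → Pt) (i : ZMod n) :
    ZMod (n - 1) → Pt :=
  fun j => V (i + 1 + (j.val : ZMod n))

end

/-- Power of the point `x` with respect to the circle with centre `O` and radius `R`. -/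
noncomputable def rgPw (O : Pt) (R : ℝ) (x : Pt) : ℝ := dist x O ^ 2 - R ^ 2

theorem rg_key (O₁ O₂ : Pt) (R₁ R₂ : ℝ) (a b c d : Pt) :
    det2 b c d * (rgPw O₁ R₁ a - rgPw O₂ R₂ a) + det2 a b d * (rgPw O₁ R₁ c - rgPw O₂ R₂ c)
      = det2 a c d * (rgPw O₁ R₁ b - rgPw O₂ R₂ b)
        + det2 a b c * (rgPw O₁ R₁ d - rgPw O₂ R₂ d) := by
  have h : ∀ x y : Pt, dist x y ^ 2 = (x 0 - y 0) ^ 2 + (x 1 - y 1) ^ 2 := by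
    intro x y
    rw [EuclideanSpace.dist_eq, Real.sq_sqrt (by positivity)]
    simp [Fin.sum_univ_two, Real.dist_eq, sq_abs]
  simp only [rgPw, h, det2]
  ring

theorem rg_rot (a b c : Pt) : det2 a b c = det2 b c a := by
  simp only [det2]; ring

theorem rg_zero {O x : Pt} {R : ℝ} (h : dist x O = R) : rgPw O R x = 0 := by
  simp [rgPw, h]

theorem rg_nonneg_iff {O x : Pt} {R : ℝ} (hR : 0 ≤ R) : R ≤ dist x O ↔ 0 ≤ rgPw O R x := by
  rw [rgPw, sub_nonneg]
  constructor
  · intro h; gcongr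
  · intro h; exact le_of_sq_le_sq h dist_nonneg

/-- Two consecutive ears overlap. -/
theorem rg_adj {O₁ O₂ : Pt} {R₁ R₂ : ℝ} {a b c d : Pt}
    (habc : 0 < det2 a b c) (hbcd : 0 < det2 b c d)
    (ha1 : dist a O₁ = R₁) (hb1 : dist b O₁ = R₁) (hc1 : dist c O₁ = R₁)
    (hb2 : dist b O₂ = R₂) (hc2 : dist c O₂ = R₂) (hd2 : dist d O₂ = R₂)
    (hd : R₁ ≤ dist d O₁) (ha : R₂ ≤ dist a O₂) (hne : dist a O₂ ≠ R₂) : False := by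
  have h := rg_key O₁ O₂ R₁ R₂ a b c d
  have hR1 : 0 ≤ R₁ := ha1 ▸ dist_nonneg
  have hR2 : 0 ≤ R₂ := hb2 ▸ dist_nonneg
  rw [rg_zero ha1, rg_zero hb1, rg_zero hc1, rg_zero hb2, rg_zero hc2, rg_zero hd2] at h
  have h1 := (rg_nonneg_iff hR1).1 hd
  have h2 : 0 < rgPw O₂ R₂ a := by
    have : R₂ < dist a O₂ := lt_of_le_of_ne ha (Ne.symm hne)
    rw [rgPw]; nlinarith
  have h3 := mul_pos hbcd h2
  have h4 := mul_nonneg habc.le h1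
  nlinarith

/-- A circle is determined by three non-collinear points. -/
theorem rg_uniq {O₁ O₂ : Pt} {R₁ R₂ : ℝ} {a b c : Pt} (habc : 0 < det2 a b c)
    (ha1 : dist a O₁ = R₁) (hb1 : dist b O₁ = R₁) (hc1 : dist c O₁ = R₁)
    (ha2 : dist a O₂ = R₂) (hb2 : dist b O₂ = R₂) (hc2 : dist c O₂ = R₂) (d : Pt) :
    R₁ ≤ dist d O₁ ↔ R₂ ≤ dist d O₂ := by
  have h := rg_key O₁ O₂ R₁ R₂ a b c d
  have hR1 : 0 ≤ R₁ := ha1 ▸ dist_nonneg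
  have hR2 : 0 ≤ R₂ := hb2 ▸ dist_nonneg
  rw [rg_zero ha1, rg_zero hb1, rg_zero hc1, rg_zero ha2, rg_zero hb2, rg_zero hc2] at h
  simp only [sub_self, mul_zero, add_zero, zero_add] at h
  have h' : rgPw O₁ R₁ d - rgPw O₂ R₂ d = 0 := by
    rcases mul_eq_zero.1 h.symm with h | h
    · exact absurd h habc.ne'
    · exact h
  rw [rg_nonneg_iff hR1, rg_nonneg_iff hR2, sub_eq_zero.1 h']

/-- Crossing argument: the circle `O₁` through `d` with `a, c` outside cannot contain `b`. -/
theorem rg_cross {O₁ O₂ : Pt} {R₁ R₂ : ℝ} {a b c d : Pt}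
    (habc : 0 < det2 a b c) (hbcd : 0 < det2 b c d) (habd : 0 < det2 a b d)
    (hacd : 0 < det2 a c d)
    (hd1 : dist d O₁ = R₁) (ha1 : R₁ ≤ dist a O₁) (hc1 : R₁ ≤ dist c O₁)
    (ha2 : dist a O₂ = R₂) (hb2 : dist b O₂ = R₂) (hc2 : dist c O₂ = R₂)
    (hd2 : R₂ ≤ dist d O₂) : R₁ ≤ dist b O₁ := by
  have h := rg_key O₁ O₂ R₁ R₂ a b c d
  have hR1 : 0 ≤ R₁ := hd1 ▸ dist_nonneg
  have hR2 : 0 ≤ R₂ := hb2 ▸ dist_nonneg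
  rw [rg_zero hd1, rg_zero ha2, rg_zero hb2, rg_zero hc2] at h
  rw [rg_nonneg_iff hR1] at *
  rw [rg_nonneg_iff hR2] at hd2
  by_contra hb
  push Not at hb
  have h1 := mul_nonneg hbcd.le ha1
  have h2 := mul_nonneg habd.le hc1
  have h3 := mul_pos hacd (neg_pos.2 hb)
  have h4 := mul_nonneg habc.le hd2
  nlinarith

/-- A vertex is never beyond a short diagonal. -/
theorem rg_diag {n : ℕ} {V : ZMod n → Pt} (hV : ConvexCCW V) (h2 : (2 : ZMod n) ≠ 0)
    (i k : ZMod n)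
    (hk : k ≠ i) (hk1 : k ≠ i + 1) (hk2 : k ≠ i - 1) :
    0 < det2 (V (i - 1)) (V (i + 1)) (V k) := by
  have hE := hV.2
  by_contra hneg
  push Not at hneg
  have w1 : 0 < det2 (V (i - 1)) (V i) (V k) := by
    have := hE (i - 1) k hk2 (by simpa using hk)
    simpa using this
  have w2 : 0 < det2 (V i) (V (i + 1)) (V k) := hE i k hk hk1
  have hle : ∀ j, 0 ≤ det2 (V k) (V (k + 1)) (V j) := by
    intro j
    by_cases h1 : j = k
    · subst h1; simp [det2]
    by_cases h2 : j = k + 1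
    · subst h2; simp only [det2]; ring_nf; rfl
    exact (hE k j h1 h2).le
  have key : det2 (V i) (V (i + 1)) (V k) * det2 (V k) (V (k + 1)) (V (i - 1))
      + det2 (V (i - 1)) (V i) (V k) * det2 (V k) (V (k + 1)) (V (i + 1))
      - det2 (V (i - 1)) (V (i + 1)) (V k) * det2 (V k) (V (k + 1)) (V i) = 0 := by
    simp only [det2]; ring
  have h3 := mul_nonneg (neg_nonneg.2 hneg) (hle i)
  have h4 := mul_nonneg w2.le (hle (i - 1))
  have h5 := mul_nonneg w1.le (hle (i + 1))
  by_cases hc : i + 1 = k + 1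
  · exact hk (add_right_cancel hc).symm
  · have := mul_pos w1 (hE k (i + 1) hk1.symm hc)
    nlinarith

theorem rg_count {α β : Type*} [Finite α] [Finite β] (S : Set α) (S' : Set β) (φ : β → α)
    (hφ : Function.Injective φ) (i p q : α) (hi : i ∈ S) (hiA : i ∉ φ '' S')
    (hp : p ∉ S) (hq : q ∉ S) (hpq : ¬ (p ∈ φ '' S' ∧ q ∈ φ '' S'))
    (h : ∀ k, k ≠ i → k ≠ p → k ≠ q → (k ∈ S ↔ k ∈ φ '' S')) :
    S.ncard = S'.ncard ∨ S.ncard = S'.ncard + 1 := by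
  have hA : (φ '' S').ncard = S'.ncard := Set.ncard_image_of_injective _ hφ
  have hS := Set.ncard_diff_singleton_add_one hi (Set.toFinite S)
  rw [← hA]
  generalize φ '' S' = A at *
  by_cases hpA : p ∈ A
  · have hqA : q ∉ A := fun hq => hpq ⟨hpA, hq⟩
    have : S \ {i} = A \ {p} := by
      ext k; by_cases k = i <;> by_cases k = p <;> by_cases k = q <;> simp_all
    have := Set.ncard_diff_singleton_add_one hpA (Set.toFinite A)
    left; simp_all
  · by_cases hqA : q ∈ A
    · have : S \ {i} = A \ {q} := by
        ext k; by_cases k = i <;> by_cases k = p <;> by_cases k = q <;> simp_all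
      have := Set.ncard_diff_singleton_add_one hqA (Set.toFinite A)
      left; simp_all
    · have : S \ {i} = A := by
        ext k; by_cases k = i <;> by_cases k = p <;> by_cases k = q <;> simp_all
      right; simp_all

/-- The index map of `removeVertex`. -/
def rgPhi {n : ℕ} (i : ZMod n) (j : ZMod (n - 1)) : ZMod n := i + 1 + (j.val : ZMod n)

section
variable {n : ℕ} [NeZero n] [NeZero (n - 1)] (hn : 5 ≤ n) (i : ZMod n)

theorem rgPhi_zero : rgPhi i (0 : ZMod (n - 1)) = i + 1 := by simp [rgPhi]

theorem rg_ne {n : ℕ} (m : ℕ) (h0 : 0 < m) (hm : m < n) : ((m : ℕ) : ZMod n) ≠ 0 := by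
  intro h
  rw [ZMod.natCast_eq_zero_iff] at h
  exact absurd (Nat.le_of_dvd h0 h) (by omega)

theorem rgPhi_ne (hn : 5 ≤ n) (j : ZMod (n - 1)) : rgPhi i j ≠ i := by
  intro h
  have hlt := ZMod.val_lt j
  apply rg_ne (n := n) (j.val + 1) (by omega) (by omega)
  push_cast
  rw [rgPhi] at h
  linear_combination h

theorem rgPhi_inj : Function.Injective (rgPhi (n := n) i) := by
  intro j k h
  have hj := ZMod.val_lt j
  have hk := ZMod.val_lt k
  have h' : (j.val : ZMod n) = (k.val : ZMod n) := by
    simpa [rgPhi] using h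
  rw [ZMod.natCast_eq_natCast_iff', Nat.mod_eq_of_lt (by omega), Nat.mod_eq_of_lt (by omega)] at h'
  exact ZMod.val_injective _ h'

theorem rgPhi_surj (k : ZMod n) (hk : k ≠ i) : ∃ j, rgPhi i j = k := by
  have hv : (k - i).val ≠ 0 := by
    intro h
    rw [ZMod.val_eq_zero] at h
    exact hk (sub_eq_zero.1 h)
  have hlt := ZMod.val_lt (k - i)
  refine ⟨(((k - i).val - 1 : ℕ) : ZMod (n - 1)), ?_⟩
  rw [rgPhi, ZMod.val_natCast, Nat.mod_eq_of_lt (by omega), Nat.cast_sub (by omega),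
    ZMod.natCast_zmod_val]
  push_cast
  ring

theorem rgPhi_succ (hn : 5 ≤ n) (j : ZMod (n - 1)) (h : rgPhi i j ≠ i - 1) :
    rgPhi i (j + 1) = rgPhi i j + 1 := by
  have hlt := ZMod.val_lt j
  by_cases hj : j.val + 1 < n - 1
  · have : (j + 1).val = j.val + 1 := by
      have h1 : (1 : ZMod (n - 1)).val = 1 := by
        have := ZMod.val_natCast_of_lt (n := n - 1) (a := 1) (by omega)
        simpa using this
      rw [ZMod.val_add_of_lt, h1]
      rw [h1]; exact hj
    simp only [rgPhi, this]
    push_cast; ring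
  · exfalso
    apply h
    have hv : j.val = n - 2 := by omega
    rw [rgPhi, hv, Nat.cast_sub (by omega)]
    simp; ring

theorem rgPhi_neg_one (hn : 5 ≤ n) : rgPhi i (-1 : ZMod (n - 1)) = i - 1 := by
  by_contra h
  have := rgPhi_succ i hn _ h
  rw [neg_add_cancel, rgPhi_zero] at this
  exact rgPhi_ne i hn _ (add_right_cancel this).symm

theorem rgPhi_pred (hn : 5 ≤ n) (j : ZMod (n - 1)) (h : rgPhi i j ≠ i + 1) :
    rgPhi i (j - 1) = rgPhi i j - 1 := by
  by_cases h' : rgPhi i (j - 1) = i - 1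
  · rw [← rgPhi_neg_one i hn] at h'
    have := rgPhi_inj i h'
    have hj : j = 0 := by linear_combination this
    rw [hj, rgPhi_zero] at h
    exact absurd rfl h
  · have := rgPhi_succ i hn _ h'
    rw [sub_add_cancel] at this
    rw [this]; ring

end

/-- Removing a globally maximal-extremal vertex from a generic convex polygon with
`n ≥ 5` vertices loses at most the count of that one vertex:
`s₋(P) = s₋(P')` or `s₋(P) = s₋(P') + 1`. -/
theorem remove_globally_maximal_vertex
    (n : ℕ) [NeZero n] [NeZero (n - 1)] (hn : 5 ≤ n)
    (V O : ZMod n → Pt) (R : ZMod n → ℝ)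
    (hconv : ConvexCCW V) (hgen : GenericPoly V) (hcirc : IsCircumData V O R)
    (i : ZMod n) (hi : GlobMax V O R i)
    (O' : ZMod (n - 1) → Pt) (R' : ZMod (n - 1) → ℝ)
    (hcirc' : IsCircumData (removeVertex V i) O' R') :
    {k : ZMod n | GlobMax V O R k}.ncard =
        {k : ZMod (n - 1) | GlobMax (removeVertex V i) O' R' k}.ncard ∨
    {k : ZMod n | GlobMax V O R k}.ncard =
        {k : ZMod (n - 1) | GlobMax (removeVertex V i) O' R' k}.ncard + 1 := by
  have e1 : (1 : ZMod n) ≠ 0 := by simpa using rg_ne (n := n) 1 (by omega) (by omega)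
  have e2 : (2 : ZMod n) ≠ 0 := by simpa using rg_ne (n := n) 2 (by omega) (by omega)
  have e3 : (3 : ZMod n) ≠ 0 := by simpa using rg_ne (n := n) 3 (by omega) (by omega)
  have e4 : (4 : ZMod n) ≠ 0 := by simpa using rg_ne (n := n) 4 (by omega) (by omega)
  have hE := hconv.2
  have hE3 : ∀ k : ZMod n, 0 < det2 (V (k - 1)) (V k) (V (k + 1)) := by
    intro k
    have := hE (k - 1) (k + 1) (fun h => e2 (by linear_combination h))
      (fun h => e1 (by linear_combination h))
    simpa using this
  have hrv : ∀ j, removeVertex V i j = V (rgPhi i j) := fun j => rfl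
  have hadj : ∀ k : ZMod n, GlobMax V O R k → GlobMax V O R (k + 1) → False := by
    intro k h1 h2
    obtain ⟨a1, b1, c1⟩ := hcirc k
    obtain ⟨b2, c2, d2⟩ := hcirc (k + 1)
    have hbcd := hE3 (k + 1)
    rw [add_sub_cancel_right] at b2 hbcd
    refine rg_adj (hE3 k) hbcd a1 b1 c1 b2 c2 d2 (h1 _) (h2 _) ?_
    intro ha
    exact hgen.2 (k - 1) k (k + 1) (k + 1 + 1) (fun h => e1 (by linear_combination -h))
      (fun h => e2 (by linear_combination -h)) (fun h => e3 (by linear_combination -h))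
      (fun h => e1 (by linear_combination -h)) (fun h => e2 (by linear_combination -h))
      (fun h => e1 (by linear_combination -h)) ⟨_, _, ha, b2, c2, d2⟩
  refine rg_count _ _ (rgPhi i) (rgPhi_inj i) i (i - 1) (i + 1) hi ?_ ?_ ?_ ?_ ?_
  · rintro ⟨j, -, hj⟩
    exact rgPhi_ne i hn j hj
  · intro h
    refine hadj (i - 1) h ?_
    rw [sub_add_cancel]; exact hi
  · intro h
    exact hadj i hi h
  · rintro ⟨⟨p, hp, hpe⟩, ⟨q, hq, hqe⟩⟩
    rw [← rgPhi_neg_one i hn] at hpe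
    have hpe := rgPhi_inj i hpe
    rw [← rgPhi_zero i] at hqe
    have hqe := rgPhi_inj i hqe
    subst hpe hqe
    have f0 := rgPhi_zero i
    have f1 := rgPhi_neg_one i hn
    have f2 : rgPhi i (0 + 1 : ZMod (n - 1)) = i + 1 + 1 := by
      rw [rgPhi_succ i hn 0 (by rw [f0]; exact fun h => e2 (by linear_combination h)), f0]
    have f3 : rgPhi i (-1 - 1 : ZMod (n - 1)) = i - 1 - 1 := by
      rw [rgPhi_pred i hn (-1) (by rw [f1]; exact fun h => e2 (by linear_combination -h)), f1]
    obtain ⟨a1, b1, c1⟩ := hcirc' (-1)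
    obtain ⟨b2, c2, d2⟩ := hcirc' 0
    have hd := hp (0 + 1)
    have ha := hq (-1 - 1)
    simp only [neg_add_cancel, zero_sub, hrv, f0, f1, f2, f3] at a1 b1 c1 b2 c2 d2 hd ha
    refine rg_adj ?_ ?_ a1 b1 c1 b2 c2 d2 hd ha ?_
    · have := hE (i - 1 - 1) (i + 1) (fun h => e3 (by linear_combination h))
        (fun h => e2 (by linear_combination h))
      simpa using this
    · rw [rg_rot]
      exact hE (i + 1) (i - 1) (fun h => e2 (by linear_combination -h))
        (fun h => e3 (by linear_combination -h))
    · intro h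
      exact hgen.2 (i - 1 - 1) (i - 1) (i + 1) (i + 1 + 1) (fun h => e1 (by linear_combination -h))
        (fun h => e3 (by linear_combination -h)) (fun h => e4 (by linear_combination -h))
        (fun h => e2 (by linear_combination -h)) (fun h => e3 (by linear_combination -h))
        (fun h => e1 (by linear_combination -h)) ⟨_, _, h, b2, c2, d2⟩
  · intro k hki hkp hkq
    obtain ⟨j, rfl⟩ := rgPhi_surj i k hki
    have hmem : rgPhi i j ∈ rgPhi i '' {k | GlobMax (removeVertex V i) O' R' k} ↔
        GlobMax (removeVertex V i) O' R' j := by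
      rw [(rgPhi_inj i).mem_set_image]; rfl
    rw [hmem]
    obtain ⟨a1, b1, c1⟩ := hcirc' j
    simp only [hrv, rgPhi_succ i hn j hkp, rgPhi_pred i hn j hkq] at a1 b1 c1
    obtain ⟨a2, b2, c2⟩ := hcirc (rgPhi i j)
    have hu := rg_uniq (hE3 (rgPhi i j)) a1 b1 c1 a2 b2 c2
    constructor
    · intro h l
      rw [hrv, hu]
      exact h _
    · intro h
      have hall : ∀ l, l ≠ i → R (rgPhi i j) ≤ dist (V l) (O (rgPhi i j)) := by
        intro l hl
        obtain ⟨l, rfl⟩ := rgPhi_surj i l hl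
        rw [← hu]
        exact h l
      intro l
      by_cases hl : l = i
      · subst hl
        obtain ⟨a3, b3, c3⟩ := hcirc l
        refine rg_cross (hE3 l) (hE l _ hki hkq) ?_ (rg_diag hconv e2 l _ hki hkq hkp) b2
          (hall _ (fun h => e1 (by linear_combination -h)))
          (hall _ (fun h => e1 (by linear_combination h))) a3 b3 c3 (hi _)
        have := hE (l - 1) _ hkp (by simpa using hki)
        simpa using this
      · exact hall l hl
end

section
/- Let P be a generic convex polygon with n ≥ 6 vertices and let P_1 and P_2 be the two polygons resulting from a decomposition of P whose cutting diagonal is Anti-Delaunay. Then s_+(P) ≥ s_+(P_1) + s_+(P_2) − 2. -/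
open EuclideanGeometry
open scoped Classical

noncomputable section

/-- The sub-polygon of `V` cut off by the diagonal from `V a` to `V (a + m)`: its
vertex sequence is `V a, V (a+1), …, V (a+m)` (so it has `m + 1` vertices and the
diagonal is one of its edges). -/
def subPolygon {n : ℕ} [NeZero n] (V : ZMod n → Pt) (a : ZMod n) (m : ℕ) :
    ZMod (m + 1) → Pt :=
  fun j => V (a + (j.val : ZMod n))

end

lemma aux_sq (X O : Pt) : dist X O ^ 2 = (X 0 - O 0) ^ 2 + (X 1 - O 1) ^ 2 := by
  rw [EuclideanSpace.dist_eq, Real.sq_sqrt (by positivity)]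
  simp [Fin.sum_univ_two, Real.dist_eq, sq_abs]

lemma aux_orient {n : ℕ} (hn : 3 ≤ n) (V : ZMod n → Pt) (h : ConvexCCW V) (c : ZMod n)
    (j : ℕ) (hj : 0 < j) (k : ℕ) (hjk : j < k) (hk : k < n) :
    0 < det2 (V c) (V (c + (j : ZMod n))) (V (c + (k : ZMod n))) := by
  have hne : ∀ s t : ℕ, s < n → t < n → s ≠ t → c + (s : ZMod n) ≠ c + (t : ZMod n) := by
    intro s t hs ht hst he
    have := add_left_cancel he
    rw [ZMod.natCast_eq_natCast_iff'] at this
    rw [Nat.mod_eq_of_lt hs, Nat.mod_eq_of_lt ht] at this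
    exact hst this
  have hedge : ∀ t : ℕ, 1 < t → t < n → 0 < det2 (V c) (V (c + 1)) (V (c + (t : ZMod n))) := by
    intro t h1 h2
    apply h.2
    · simpa using hne t 0 h2 (by omega) (by omega)
    · simpa using hne t 1 h2 (by omega) (by omega)
  have hnext : ∀ t : ℕ, 0 < t → t + 1 < n →
      0 < det2 (V c) (V (c + (t : ZMod n))) (V (c + ((t + 1 : ℕ) : ZMod n))) := by
    intro t h1 h2
    have := h.2 (c + (t : ZMod n)) c
      (by simpa using hne 0 t (by omega) (by omega) (by omega))
      (by simpa [add_assoc] using hne 0 (t + 1) (by omega) (by omega) (by omega))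
    rw [add_assoc] at this
    push_cast
    unfold det2 at this ⊢
    linarith
  induction k, hjk using Nat.le_induction with
  | base => exact hnext j hj hk
  | succ k hjk ih =>
    have h1 := ih (by omega)
    have h2 := hnext k (by omega) hk
    have h3 := hedge k (by omega) (by omega)
    have h4 := hedge (k + 1) (by omega) hk
    have h5 : 0 ≤ det2 (V c) (V (c + 1)) (V (c + (j : ZMod n))) := by
      by_cases hj1 : j = 1
      · subst hj1
        simp [det2]
        linarith
      · exact (hedge j (by omega) (by omega)).le
    generalize V (c + ((k + 1 : ℕ) : ZMod n)) = X at *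
    generalize V (c + (k : ZMod n)) = Y at *
    generalize V (c + (j : ZMod n)) = Z at *
    generalize V (c + 1) = E at *
    have key : det2 (V c) E Y * det2 (V c) Z X =
        det2 (V c) E Z * det2 (V c) Y X + det2 (V c) E X * det2 (V c) Z Y := by
      unfold det2; ring
    have : 0 < det2 (V c) E Y * det2 (V c) Z X := by
      rw [key]; positivity
    exact pos_of_mul_pos_right this h3.le

lemma aux_cross (A B K J O C : Pt) (r s : ℝ)
    (h1 : 0 < det2 A K B) (h2 : 0 < det2 A B J) (h3 : 0 < det2 A K J) (h4 : 0 < det2 K B J)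
    (hA : dist A C = s) (hB : dist B C = s) (hK : dist K C < s) (hJ : dist J C < s)
    (oA : dist A O ≤ r) (oB : dist B O ≤ r) (oK : dist K O = r) : dist J O < r := by
  have hr : 0 ≤ r := oK ▸ dist_nonneg
  have a1 : dist A C ^ 2 = s ^ 2 := by rw [hA]
  have a2 : dist B C ^ 2 = s ^ 2 := by rw [hB]
  have a3 : dist K C ^ 2 < s ^ 2 := pow_lt_pow_left₀ hK dist_nonneg (by norm_num)
  have a4 : dist J C ^ 2 < s ^ 2 := pow_lt_pow_left₀ hJ dist_nonneg (by norm_num)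
  have b1 : dist A O ^ 2 ≤ r ^ 2 := pow_le_pow_left₀ dist_nonneg oA 2
  have b2 : dist B O ^ 2 ≤ r ^ 2 := pow_le_pow_left₀ dist_nonneg oB 2
  have b3 : dist K O ^ 2 = r ^ 2 := by rw [oK]
  apply lt_of_pow_lt_pow_left₀ 2 hr
  have key : det2 A B J * ((dist K O ^ 2 - r ^ 2) - (dist K C ^ 2 - s ^ 2))
      + det2 A K B * ((dist J O ^ 2 - r ^ 2) - (dist J C ^ 2 - s ^ 2))
      = det2 K B J * ((dist A O ^ 2 - r ^ 2) - (dist A C ^ 2 - s ^ 2))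
      + det2 A K J * ((dist B O ^ 2 - r ^ 2) - (dist B C ^ 2 - s ^ 2)) := by
    simp only [aux_sq]; unfold det2; ring
  rw [a1, a2, b3] at key
  have e1 : 0 < det2 A B J * ((r ^ 2 - r ^ 2) - (dist K C ^ 2 - s ^ 2)) :=
    mul_pos h2 (by linarith)
  have e2 : det2 K B J * ((dist A O ^ 2 - r ^ 2) - (s ^ 2 - s ^ 2)) ≤ 0 :=
    mul_nonpos_of_nonneg_of_nonpos h4.le (by linarith)
  have e3 : det2 A K J * ((dist B O ^ 2 - r ^ 2) - (s ^ 2 - s ^ 2)) ≤ 0 :=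
    mul_nonpos_of_nonneg_of_nonpos h3.le (by linarith)
  have e4 : det2 A K B * ((dist J O ^ 2 - r ^ 2) - (dist J C ^ 2 - s ^ 2)) < 0 := by linarith
  have e5 := neg_of_mul_neg_right e4 h1.le
  linarith

lemma aux_center (A B C O Q : Pt) (r s : ℝ) (h : 0 < det2 A B C)
    (a1 : dist A O = r) (a2 : dist B O = r) (a3 : dist C O = r)
    (b1 : dist A Q = s) (b2 : dist B Q = s) (b3 : dist C Q = s) : O = Q ∧ r = s := by
  have e1 : dist A O ^ 2 - dist B O ^ 2 = dist A Q ^ 2 - dist B Q ^ 2 := by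
    rw [a1, a2, b1, b2]; ring
  have e2 : dist A O ^ 2 - dist C O ^ 2 = dist A Q ^ 2 - dist C Q ^ 2 := by
    rw [a1, a3, b1, b3]; ring
  simp only [aux_sq] at e1 e2
  have hO : O = Q := by
    ext i
    have h0 : det2 A B C * (O 0 - Q 0) = 0 := by
      unfold det2
      linear_combination (C 1 - A 1) / 2 * e1 - (B 1 - A 1) / 2 * e2
    have h1 : det2 A B C * (O 1 - Q 1) = 0 := by
      unfold det2
      linear_combination (B 0 - A 0) / 2 * e2 - (C 0 - A 0) / 2 * e1
    have h0' := (mul_eq_zero.1 h0).resolve_left h.ne'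
    have h1' := (mul_eq_zero.1 h1).resolve_left h.ne'
    fin_cases i
    · simpa using sub_eq_zero.1 h0'
    · simpa using sub_eq_zero.1 h1'
  exact ⟨hO, by rw [← a1, ← b1, hO]⟩

lemma aux_pencil (A B X Y O Q : Pt) (r s : ℝ) (h1 : 0 < det2 A X B) (h2 : 0 < det2 A Y B)
    (a1 : dist A O = r) (a2 : dist B O = r) (a3 : dist X O = r) (a4 : dist Y O < r)
    (b1 : dist A Q = s) (b2 : dist B Q = s) (b3 : dist Y Q = s) (b4 : dist X Q < s) : False := by
  have a5 : dist Y O ^ 2 < r ^ 2 := pow_lt_pow_left₀ a4 dist_nonneg (by norm_num)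
  have b5 : dist X Q ^ 2 < s ^ 2 := pow_lt_pow_left₀ b4 dist_nonneg (by norm_num)
  have key : det2 A X B * ((dist Y O ^ 2 - r ^ 2) - (dist Y Q ^ 2 - s ^ 2))
      + (det2 A Y X - det2 A Y B + det2 A X B - det2 A X B) * 0
      + det2 A Y X * ((dist B O ^ 2 - r ^ 2) - (dist B Q ^ 2 - s ^ 2))
      = det2 A Y B * ((dist X O ^ 2 - r ^ 2) - (dist X Q ^ 2 - s ^ 2))
      + (det2 A X B - det2 A Y B + det2 A Y X) *
        ((dist A O ^ 2 - r ^ 2) - (dist A Q ^ 2 - s ^ 2)) := by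
    simp only [aux_sq]; unfold det2; ring
  rw [a1, a2, a3, b1, b2, b3] at key
  nlinarith [mul_pos h1 (sub_pos.2 a5), mul_pos h2 (sub_pos.2 b5)]

lemma aux_sub {n : ℕ} [NeZero n] (V : ZMod n → Pt) (a : ZMod n) (m t : ℕ) (ht : t ≤ m) :
    subPolygon V a m (t : ZMod (m + 1)) = V (a + (t : ZMod n)) := by
  unfold subPolygon
  rw [ZMod.val_natCast_of_lt (by omega)]

lemma aux_cast_ne {n : ℕ} {s t : ℕ} (hs : s < n) (ht : t < n) (h : s ≠ t) :
    (s : ZMod n) ≠ (t : ZMod n) := by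
  intro he
  rw [ZMod.natCast_eq_natCast_iff', Nat.mod_eq_of_lt hs, Nat.mod_eq_of_lt ht] at he
  exact h he

lemma aux_globmin (n : ℕ) [NeZero n] (hn : 6 ≤ n)
    (V O : ZMod n → Pt) (R : ZMod n → ℝ)
    (hconv : ConvexCCW V) (hcirc : IsCircumData V O R)
    (a : ZMod n) (m : ℕ) (hm3 : 3 ≤ m) (hmn : m ≤ n - 3)
    (hdel : ∃ (Oc : Pt) (Rc : ℝ), dist (V a) Oc = Rc ∧
      dist (V (a + (m : ZMod n))) Oc = Rc ∧
      ∀ j : ZMod n, j ≠ a → j ≠ a + (m : ZMod n) → dist (V j) Oc < Rc)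
    (O1 : ZMod (m + 1) → Pt) (R1 : ZMod (m + 1) → ℝ)
    (hc1 : IsCircumData (subPolygon V a m) O1 R1) (i : ℕ) (hi0 : 0 < i) (him : i < m)
    (hg : GlobMin (subPolygon V a m) O1 R1 (i : ZMod (m + 1))) :
    GlobMin V O R (a + (i : ZMod n)) := by
  obtain ⟨Oc, Rc, d1, d2, d3⟩ := hdel
  obtain ⟨i, rfl⟩ : ∃ i', i = i' + 1 := ⟨i - 1, by omega⟩
  have hc := hc1 ((i + 1 : ℕ) : ZMod (m + 1))
  have hp1 : (((i + 1 : ℕ) : ZMod (m + 1)) - 1) = (i : ZMod (m + 1)) := by push_cast; ring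
  have hp2 : (((i + 1 : ℕ) : ZMod (m + 1)) + 1) = ((i + 2 : ℕ) : ZMod (m + 1)) := by
    push_cast; ring
  have hq1 : (a + ((i + 1 : ℕ) : ZMod n) - 1) = a + (i : ZMod n) := by push_cast; ring
  have hq2 : (a + ((i + 1 : ℕ) : ZMod n) + 1) = a + ((i + 2 : ℕ) : ZMod n) := by push_cast; ring
  rw [hp1, hp2, aux_sub _ _ _ _ (by omega), aux_sub _ _ _ _ (by omega),
    aux_sub _ _ _ _ (by omega)] at hc
  have hd := hcirc (a + ((i + 1 : ℕ) : ZMod n))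
  rw [hq1, hq2] at hd
  have hdet : 0 < det2 (V (a + (i : ZMod n))) (V (a + ((i + 1 : ℕ) : ZMod n)))
      (V (a + ((i + 2 : ℕ) : ZMod n))) := by
    have := aux_orient (by omega) V hconv (a + (i : ZMod n)) 1 (by omega) 2 (by omega) (by omega)
    convert this using 3 <;> push_cast <;> ring
  obtain ⟨hO, hR⟩ := aux_center _ _ _ _ _ _ _ hdet hd.1 hd.2.1 hd.2.2 hc.1 hc.2.1 hc.2.2
  have hlt : ∀ t : ℕ, t ≤ m → t ≠ i → t ≠ i + 1 → t ≠ i + 2 →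
      dist (V (a + (t : ZMod n))) (O1 ((i + 1 : ℕ) : ZMod (m + 1))) <
        R1 ((i + 1 : ℕ) : ZMod (m + 1)) := by
    intro t ht h1 h2 h3
    rw [← aux_sub V a m t ht]
    apply hg
    · rw [hp1]; exact aux_cast_ne (by omega) (by omega) h1
    · exact aux_cast_ne (by omega) (by omega) h2
    · rw [hp2]; exact aux_cast_ne (by omega) (by omega) h3
  have hle : ∀ t : ℕ, t ≤ m →
      dist (V (a + (t : ZMod n))) (O1 ((i + 1 : ℕ) : ZMod (m + 1))) ≤
        R1 ((i + 1 : ℕ) : ZMod (m + 1)) := by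
    intro t ht
    by_cases h1 : t = i
    · rw [h1]; exact hc.1.le
    by_cases h2 : t = i + 1
    · rw [h2]; exact hc.2.1.le
    by_cases h3 : t = i + 2
    · rw [h3]; exact hc.2.2.le
    exact (hlt t ht h1 h2 h3).le
  intro j hj1 hj2 hj3
  rw [hO, hR]
  obtain ⟨t, htn, rfl⟩ : ∃ t : ℕ, t < n ∧ j = a + (t : ZMod n) :=
    ⟨(j - a).val, ZMod.val_lt _, by rw [ZMod.natCast_zmod_val]; ring⟩
  rw [hq1] at hj1
  rw [hq2] at hj3
  by_cases htm : t ≤ m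
  · apply hlt t htm
    · rintro rfl; exact hj1 rfl
    · rintro rfl; exact hj2 rfl
    · rintro rfl; exact hj3 rfl
  · push Not at htm
    have hin : ∀ s : ℕ, s < n → s ≠ 0 → s ≠ m → dist (V (a + (s : ZMod n))) Oc < Rc := by
      intro s hs h0 h1
      apply d3
      · have := aux_cast_ne (n := n) hs (t := 0) (by omega) h0
        simpa using this
      · have := aux_cast_ne (n := n) hs (t := m) (by omega) h1
        simpa using this
    refine aux_cross (V a) (V (a + (m : ZMod n))) (V (a + ((i + 1 : ℕ) : ZMod n))) _ _ Oc _ Rc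
      ?_ ?_ ?_ ?_ d1 d2 (hin _ (by omega) (by omega) (by omega))
      (hin _ (by omega) (by omega) (by omega)) ?_ (hle m le_rfl) hc.2.1
    · exact aux_orient (by omega) V hconv a _ (by omega) _ (by omega) (by omega)
    · exact aux_orient (by omega) V hconv a _ (by omega) _ (by omega) (by omega)
    · exact aux_orient (by omega) V hconv a _ (by omega) _ (by omega) (by omega)
    · have := aux_orient (by omega) V hconv (a + ((i + 1 : ℕ) : ZMod n)) (m - (i + 1)) (by omega)
        (t - (i + 1)) (by omega) (by omega)
      rwa [add_assoc, add_assoc, ← Nat.cast_add, ← Nat.cast_add,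
        show i + 1 + (m - (i + 1)) = m by omega, show i + 1 + (t - (i + 1)) = t by omega] at this
    · simpa using hle 0 (by omega)

lemma aux_notboth (n : ℕ) [NeZero n] (hn : 6 ≤ n)
    (V : ZMod n → Pt) (hconv : ConvexCCW V)
    (a : ZMod n) (m : ℕ) (hm3 : 3 ≤ m) (hmn : m ≤ n - 3)
    (O1 : ZMod (m + 1) → Pt) (R1 : ZMod (m + 1) → ℝ)
    (hc1 : IsCircumData (subPolygon V a m) O1 R1)
    (hg0 : GlobMin (subPolygon V a m) O1 R1 0)
    (hgm : GlobMin (subPolygon V a m) O1 R1 (m : ZMod (m + 1))) : False := by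
  have hz : ((m : ZMod (m + 1)) + 1) = ((0 : ℕ) : ZMod (m + 1)) := by
    have := ZMod.natCast_self (m + 1)
    push_cast at this ⊢
    exact this
  have hz' : ((0 : ℕ) : ZMod (m + 1)) - 1 = (m : ZMod (m + 1)) := by rw [← hz]; ring
  have hz1 : ((0 : ℕ) : ZMod (m + 1)) + 1 = ((1 : ℕ) : ZMod (m + 1)) := by push_cast; ring
  have hzm : (m : ZMod (m + 1)) - 1 = ((m - 1 : ℕ) : ZMod (m + 1)) := by
    rw [Nat.cast_sub (by omega)]; push_cast; ring
  rw [← Nat.cast_zero] at hg0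
  have c0 := hc1 ((0 : ℕ) : ZMod (m + 1))
  have cm := hc1 (m : ZMod (m + 1))
  have g0 := hg0 ((m - 1 : ℕ) : ZMod (m + 1))
    (by rw [hz']; exact aux_cast_ne (by omega) (by omega) (by omega))
    (aux_cast_ne (by omega) (by omega) (by omega))
    (by rw [hz1]; exact aux_cast_ne (by omega) (by omega) (by omega))
  have gm := hgm ((1 : ℕ) : ZMod (m + 1))
    (by rw [hzm]; exact aux_cast_ne (by omega) (by omega) (by omega))
    (aux_cast_ne (by omega) (by omega) (by omega))
    (by rw [hz]; exact aux_cast_ne (by omega) (by omega) (by omega))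
  rw [hz', hz1, aux_sub _ _ _ _ (by omega), aux_sub _ _ _ _ (by omega),
    aux_sub _ _ _ _ (by omega)] at c0
  rw [hz, hzm, aux_sub _ _ _ _ (by omega), aux_sub _ _ _ _ (by omega),
    aux_sub _ _ _ _ (by omega)] at cm
  rw [aux_sub _ _ _ _ (by omega)] at g0 gm
  have o1 := aux_orient (by omega) V hconv a 1 (by omega) m (by omega) (by omega)
  have o2 := aux_orient (by omega) V hconv a (m - 1) (by omega) m (by omega) (by omega)
  have ha : a + ((0 : ℕ) : ZMod n) = a := by simp
  rw [ha] at c0 cm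
  exact aux_pencil _ _ _ _ _ _ _ _ o1 o2 c0.2.1 c0.1 c0.2.2 g0 cm.2.2 cm.2.1 cm.1 gm

lemma aux_count (n : ℕ) [NeZero n] (hn : 6 ≤ n)
    (V O : ZMod n → Pt) (R : ZMod n → ℝ)
    (hconv : ConvexCCW V) (hcirc : IsCircumData V O R)
    (a : ZMod n) (m : ℕ) (hm3 : 3 ≤ m) (hmn : m ≤ n - 3)
    (hdel : ∃ (Oc : Pt) (Rc : ℝ), dist (V a) Oc = Rc ∧
      dist (V (a + (m : ZMod n))) Oc = Rc ∧
      ∀ j : ZMod n, j ≠ a → j ≠ a + (m : ZMod n) → dist (V j) Oc < Rc)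
    (O1 : ZMod (m + 1) → Pt) (R1 : ZMod (m + 1) → ℝ)
    (hc1 : IsCircumData (subPolygon V a m) O1 R1) :
    {k : ZMod (m + 1) | GlobMin (subPolygon V a m) O1 R1 k}.ncard ≤
      {k : ZMod n | GlobMin V O R k ∧ ∃ i : ℕ, 0 < i ∧ i < m ∧ k = a + (i : ZMod n)}.ncard + 1 := by
  set S := {k : ZMod (m + 1) | GlobMin (subPolygon V a m) O1 R1 k} with hS
  have hends : (S ∩ {0, (m : ZMod (m + 1))}).ncard ≤ 1 := by
    rw [Set.ncard_le_one_iff]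
    rintro x y ⟨hx, hx'⟩ ⟨hy, hy'⟩
    have nb := aux_notboth n hn V hconv a m hm3 hmn O1 R1 hc1
    rcases hx' with rfl | rfl <;> rcases hy' with rfl | rfl
    · rfl
    · exact (nb hx hy).elim
    · exact (nb hy hx).elim
    · rfl
  have hmid : (S \ {0, (m : ZMod (m + 1))}).ncard ≤
      {k : ZMod n | GlobMin V O R k ∧
        ∃ i : ℕ, 0 < i ∧ i < m ∧ k = a + (i : ZMod n)}.ncard := by
    apply Set.ncard_le_ncard_of_injOn (fun k => a + (k.val : ZMod n))
    · rintro k ⟨hk, hk'⟩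
      have hlt := ZMod.val_lt k
      have hv : ((k.val : ℕ) : ZMod (m + 1)) = k := ZMod.natCast_zmod_val k
      have h0 : k.val ≠ 0 := by
        intro h; apply hk'; left; rw [← hv, h]; simp
      have h1 : k.val ≠ m := by
        intro h; apply hk'; right; rw [← hv, h]; rfl
      refine ⟨?_, k.val, by omega, by omega, rfl⟩
      apply aux_globmin n hn V O R hconv hcirc a m hm3 hmn hdel O1 R1 hc1 _ (by omega) (by omega)
      rw [hv]; exact hk
    · intro k _ l _ h
      by_contra hne
      have := ZMod.val_lt k
      have := ZMod.val_lt l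
      exact aux_cast_ne (n := n) (s := k.val) (t := l.val) (by omega) (by omega)
        (fun h => hne (ZMod.val_injective _ h)) (add_left_cancel h)
  have := Set.ncard_inter_add_ncard_sdiff_eq_ncard S {0, (m : ZMod (m + 1))}
  omega

/-- Decomposing a generic convex polygon with `n ≥ 6` vertices along an Anti-Delaunay
diagonal (some circle through the endpoints `V a` and `V (a+m)` of the diagonal has
every other vertex of `P` in its open disk) satisfies `s₊(P) ≥ s₊(P₁) + s₊(P₂) - 2`. -/
theorem decomposition_antidelaunay_global_min
    (n : ℕ) [NeZero n] (hn : 6 ≤ n)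
    (V O : ZMod n → Pt) (R : ZMod n → ℝ)
    (hconv : ConvexCCW V) (hgen : GenericPoly V) (hcirc : IsCircumData V O R)
    (a : ZMod n) (m : ℕ) (hm3 : 3 ≤ m) (hmn : m ≤ n - 3)
    (hdel : ∃ (Oc : Pt) (Rc : ℝ), dist (V a) Oc = Rc ∧
      dist (V (a + (m : ZMod n))) Oc = Rc ∧
      ∀ j : ZMod n, j ≠ a → j ≠ a + (m : ZMod n) → dist (V j) Oc < Rc)
    (O1 : ZMod (m + 1) → Pt) (R1 : ZMod (m + 1) → ℝ)
    (hc1 : IsCircumData (subPolygon V a m) O1 R1)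
    (O2 : ZMod (n - m + 1) → Pt) (R2 : ZMod (n - m + 1) → ℝ)
    (hc2 : IsCircumData (subPolygon V (a + (m : ZMod n)) (n - m)) O2 R2) :
    {k : ZMod (m + 1) | GlobMin (subPolygon V a m) O1 R1 k}.ncard +
      {k : ZMod (n - m + 1) |
        GlobMin (subPolygon V (a + (m : ZMod n)) (n - m)) O2 R2 k}.ncard ≤
    {k : ZMod n | GlobMin V O R k}.ncard + 2 := by
  have c1 := aux_count n hn V O R hconv hcirc a m hm3 hmn hdel O1 R1 hc1
  have hb : a + (m : ZMod n) + ((n - m : ℕ) : ZMod n) = a := by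
    rw [add_assoc, ← Nat.cast_add, show m + (n - m) = n by omega]; simp
  have c2 := aux_count n hn V O R hconv hcirc (a + (m : ZMod n)) (n - m) (by omega) (by omega)
    (by
      obtain ⟨Oc, Rc, d1, d2, d3⟩ := hdel
      refine ⟨Oc, Rc, d2, by rw [hb]; exact d1, ?_⟩
      rw [hb]
      exact fun j h1 h2 => d3 j h2 h1) O2 R2 hc2
  have hdisj : Disjoint
      {k : ZMod n | GlobMin V O R k ∧ ∃ i : ℕ, 0 < i ∧ i < m ∧ k = a + (i : ZMod n)}
      {k : ZMod n | GlobMin V O R k ∧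
        ∃ i : ℕ, 0 < i ∧ i < n - m ∧ k = a + (m : ZMod n) + (i : ZMod n)} := by
    rw [Set.disjoint_left]
    rintro k ⟨_, i, _, hi, rfl⟩ ⟨_, j, _, hj, h⟩
    rw [add_assoc, ← Nat.cast_add] at h
    exact aux_cast_ne (by omega) (by omega) (by omega) (add_left_cancel h)
  have hu := Set.ncard_union_eq hdisj
  have hsub := Set.ncard_le_ncard (s := {k : ZMod n | GlobMin V O R k ∧
      ∃ i : ℕ, 0 < i ∧ i < m ∧ k = a + (i : ZMod n)} ∪ {k : ZMod n | GlobMin V O R k ∧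
        ∃ i : ℕ, 0 < i ∧ i < n - m ∧ k = a + (m : ZMod n) + (i : ZMod n)})
      (t := {k : ZMod n | GlobMin V O R k}) (by
        rintro k (hk | hk)
        · exact hk.1
        · exact hk.1) (Set.toFinite _)
  omega
end
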